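/- arXiv:2109.04789 — 4 statements merged into one kernel-verified Lean document; each statement's English description precedes it below -/
import Mathlib

section
/- Let E be a real normed vector space, let S ⊆ E be a convex subset, let u ∈ S, let v ∈ E, let r > 0 and ε ≥ 0. Suppose that every w ∈ closedBall(u, r) admits some w′ ∈ S with ‖w − w′‖ ≤ ε. Then hausdorffDist(S ∩ closedBall(u, r), closedBall(v, r)) ≤ ‖u − v‖ + 4ε. In particular, every point of closedBall(u, r) lies within distance 4ε of S ∩ closedBall(u, r). -/
/-- Shrinking an `ε`-approximation of `w` towards the center `u` by the factor `r / (r + ε)`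
brings it into the ball at the cost of another `ε`. -/
theorem Convex.exists_mem_inter_closedBall_dist_le
    {E : Type*} [NormedAddCommGroup E] [NormedSpace ℝ E]
    {S : Set E} (hS : Convex ℝ S) {u w w' : E} (hu : u ∈ S) (hw' : w' ∈ S) {r ε : ℝ}
    (hr : 0 < r) (hε : 0 ≤ ε) (hw : w ∈ Metric.closedBall u r) (hww' : ‖w - w'‖ ≤ ε) :
    ∃ p ∈ S ∩ Metric.closedBall u r, dist w p ≤ 2 * ε := by
  have hpos : 0 < r + ε := by positivity
  have hnorm : ‖w' - u‖ ≤ r + ε := by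
    rw [mem_closedBall_iff_norm] at hw
    rw [norm_sub_rev] at hww'
    linarith [norm_sub_le_norm_sub_add_norm_sub w' w u]
  refine ⟨AffineMap.lineMap u w' (r / (r + ε)), ⟨?_, ?_⟩, ?_⟩
  · exact hS.lineMap_mem hu hw' ⟨by positivity, (div_le_one hpos).2 (by linarith)⟩
  · rw [Metric.mem_closedBall, dist_lineMap_left, Real.norm_of_nonneg (by positivity),
      dist_comm, dist_eq_norm]
    calc r / (r + ε) * ‖w' - u‖ ≤ r / (r + ε) * (r + ε) := by gcongr
      _ = r := div_mul_cancel₀ r hpos.ne'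
  · have hfactor : 1 - r / (r + ε) = ε / (r + ε) := by field_simp; ring
    have hshrink : dist w' (AffineMap.lineMap u w' (r / (r + ε))) ≤ ε := by
      rw [dist_right_lineMap, hfactor, Real.norm_of_nonneg (by positivity),
        dist_comm, dist_eq_norm]
      calc ε / (r + ε) * ‖w' - u‖ ≤ ε / (r + ε) * (r + ε) := by gcongr
        _ = ε := div_mul_cancel₀ ε hpos.ne'
    rw [← dist_eq_norm] at hww'
    linarith [dist_triangle w w' (AffineMap.lineMap u w' (r / (r + ε)))]

/-- If every point of the closed ball `closedBall u r` can be approximated within `ε` by a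
point of a convex set `S` containing the center `u`, then the Hausdorff distance between
`S ∩ closedBall u r` and any closed ball `closedBall v r` of the same radius is at most
`‖u - v‖ + 4ε`; in particular every point of `closedBall u r` lies within distance `4ε`
of `S ∩ closedBall u r`. -/
theorem hausdorffDist_convex_inter_closedBall_le
    {E : Type*} [NormedAddCommGroup E] [NormedSpace ℝ E]
    (S : Set E) (hS : Convex ℝ S) (u : E) (hu : u ∈ S) (v : E) (r ε : ℝ)
    (hr : 0 < r) (hε : 0 ≤ ε)
    (happrox : ∀ w ∈ Metric.closedBall u r, ∃ w' ∈ S, ‖w - w'‖ ≤ ε) :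
    Metric.hausdorffDist (S ∩ Metric.closedBall u r) (Metric.closedBall v r)
        ≤ ‖u - v‖ + 4 * ε ∧
      ∀ w ∈ Metric.closedBall u r,
        Metric.infDist w (S ∩ Metric.closedBall u r) ≤ 4 * ε := by
  have hball : ∀ w ∈ Metric.closedBall u r,
      ∃ p ∈ S ∩ Metric.closedBall u r, dist w p ≤ 2 * ε := by
    intro w hw
    obtain ⟨w', hw', hww'⟩ := happrox w hw
    exact hS.exists_mem_inter_closedBall_dist_le hu hw' hr hε hw hww'
  refine ⟨Metric.hausdorffDist_le_of_mem_dist (by positivity) ?_ ?_, ?_⟩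
  · rintro x ⟨-, hx⟩
    refine ⟨x - (u - v), ?_, ?_⟩
    · rw [mem_closedBall_iff_norm] at hx ⊢
      rwa [show x - (u - v) - v = x - u by abel]
    · rw [dist_self_sub_right]
      linarith
  · intro x hx
    obtain ⟨p, hp, hdist⟩ := hball (x + (u - v)) (by
      rw [mem_closedBall_iff_norm] at hx ⊢
      rwa [show x + (u - v) - u = x - v by abel])
    refine ⟨p, hp, ?_⟩
    have htranslate : dist x (x + (u - v)) = ‖u - v‖ := by
      rw [dist_comm, dist_eq_norm, add_sub_cancel_left]
    linarith [dist_triangle x (x + (u - v)) p]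
  · intro w hw
    obtain ⟨p, hp, hdist⟩ := hball w hw
    linarith [Metric.infDist_le_dist_of_mem (x := w) hp]
end

section
/- Let S be a nonempty finite type, p : S → ℝ with p(s) ≥ 0 for all s, Z a type, and for each s ∈ S let U(s) ⊆ Z be a nonempty set. Let f : S → Z → ℝ be such that for each s, f(s) is bounded below on U(s). Then the infimum, over all selections 𝔲 : S → Z with 𝔲(s) ∈ U(s) for every s, of Σ_{s ∈ S} p(s)·f(s)(𝔲(s)), equals Σ_{s ∈ S} p(s)·inf_{z ∈ U(s)} f(s)(z). -/
/-- Finite-scenario rectangularity: the worst case over state-wise selections from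
state-dependent sets of a weighted sum decomposes into the weighted sum of the
state-wise worst cases. -/
theorem iInf_selection_sum_eq_sum_iInf
    {S : Type*} [Fintype S] [Nonempty S] (p : S → ℝ) (hp : ∀ s, 0 ≤ p s)
    {Z : Type*} (U : S → Set Z) (hne : ∀ s, (U s).Nonempty)
    (f : S → Z → ℝ) (hbd : ∀ s, BddBelow (f s '' U s)) :
    (⨅ 𝔲 : {g : S → Z // ∀ s, g s ∈ U s}, ∑ s, p s * f s (𝔲.1 s))
      = ∑ s, p s * ⨅ z : U s, f s z := by
  have hbd' : ∀ s, BddBelow (Set.range fun z : U s => f s z) := fun s => by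
    simpa only [Set.image_eq_range] using hbd s
  have lower (g : {g : S → Z // ∀ s, g s ∈ U s}) :
      ∑ s, p s * ⨅ z : U s, f s z ≤ ∑ s, p s * f s (g.1 s) :=
    Finset.sum_le_sum fun s _ =>
      mul_le_mul_of_nonneg_left (ciInf_le (hbd' s) ⟨g.1 s, g.2 s⟩) (hp s)
  choose z₀ hz₀ using hne
  have : Nonempty {g : S → Z // ∀ s, g s ∈ U s} := ⟨⟨z₀, hz₀⟩⟩
  refine le_antisymm (le_of_forall_pos_le_add fun ε hε => ?_) (le_ciInf lower)
  have hP : 0 ≤ ∑ s, p s := Finset.sum_nonneg fun s _ => hp s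
  set δ := ε / (∑ s, p s + 1)
  have hδ_pos : 0 < δ := by positivity
  have near (s : S) : ∃ z : U s, f s z < (⨅ z : U s, f s z) + δ :=
    have : Nonempty (U s) := ⟨⟨z₀ s, hz₀ s⟩⟩
    exists_lt_of_ciInf_lt (lt_add_of_pos_right _ hδ_pos)
  choose z hz using near
  calc (⨅ 𝔲 : {g : S → Z // ∀ s, g s ∈ U s}, ∑ s, p s * f s (𝔲.1 s))
      ≤ ∑ s, p s * f s (z s) :=
        ciInf_le ⟨_, Set.forall_mem_range.2 lower⟩
          (⟨fun s => z s, fun s => (z s).2⟩ : {g : S → Z // ∀ s, g s ∈ U s})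
    _ ≤ ∑ s, p s * ((⨅ z : U s, f s z) + δ) :=
        Finset.sum_le_sum fun s _ => mul_le_mul_of_nonneg_left (hz s).le (hp s)
    _ = ∑ s, p s * (⨅ z : U s, f s z) + (∑ s, p s) * δ := by
        simp only [mul_add, Finset.sum_add_distrib, Finset.sum_mul]
    _ ≤ ∑ s, p s * (⨅ z : U s, f s z) + ε := by
        have : (∑ s, p s + 1) * δ = ε := mul_div_cancel₀ ε (by positivity)
        linarith
end

section
/- Let S be a nonempty finite type and p : S → ℝ with p(s) ≥ 0 for all s. Let X₁ be a nonempty set, and for each x₁ ∈ X₁ and s ∈ S let X₂(x₁, s) be a nonempty set of second-stage decisions; let U₁ be a nonempty set and for each s ∈ S let U₂(s) be a nonempty set. Let f₁ : X₁ → U₁-elements → ℝ and f₂ : S → second-stage decisions → U₂-elements → ℝ, and suppose there is M ≥ 0 with |f₁(x₁, u₁)| ≤ M and |f₂(s, x₂, u₂)| ≤ M for all relevant arguments. Then: sup over (x₁ ∈ X₁ and selections x₂ : S → decisions with x₂(s) ∈ X₂(x₁, s)) of inf over (u₁ ∈ U₁ and selections u₂ : S → elements with u₂(s) ∈ U₂(s))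 of [ f₁(x₁, u₁) + Σ_{s ∈ S} p(s)·f₂(s, x₂(s), u₂(s)) ] equals sup_{x₁ ∈ X₁} [ inf_{u₁ ∈ U₁} f₁(x₁, u₁) + Σ_{s ∈ S} p(s)·sup_{x₂ ∈ X₂(x₁, s)} inf_{u₂ ∈ U₂(s)} f₂(s, x₂, u₂) ]. -/
theorem le_sum_mul_iInf {S : Type*} [Fintype S] {ι : S → Type*} [∀ s, Nonempty (ι s)]
    {p : S → ℝ} (hp : ∀ s, 0 ≤ p s) {g : ∀ s, ι s → ℝ} {c : ℝ}
    (h : ∀ u : ∀ s, ι s, c ≤ ∑ s, p s * g s (u s)) :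
    c ≤ ∑ s, p s * ⨅ i, g s i := by
  have hP : 0 < ∑ s, p s + 1 := by
    have := Finset.sum_nonneg fun s (_ : s ∈ Finset.univ) => hp s
    linarith
  refine le_of_forall_pos_le_add fun ε hε => ?_
  have hδ : 0 < ε / (∑ s, p s + 1) := div_pos hε hP
  choose u hu using fun s => exists_lt_of_ciInf_lt (lt_add_of_pos_right (⨅ i, g s i) hδ)
  calc
    c ≤ ∑ s, p s * g s (u s) := h u
    _ ≤ ∑ s, p s * ((⨅ i, g s i) + ε / (∑ s, p s + 1)) :=
      Finset.sum_le_sum fun s _ => mul_le_mul_of_nonneg_left (hu s).le (hp s)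
    _ = ∑ s, p s * (⨅ i, g s i) + (∑ s, p s) * (ε / (∑ s, p s + 1)) := by
      simp only [mul_add, Finset.sum_add_distrib, Finset.sum_mul]
    _ ≤ ∑ s, p s * (⨅ i, g s i) + ε := by
      have h' : (∑ s, p s + 1) * (ε / (∑ s, p s + 1)) = ε := by field_simp
      linarith

theorem sum_mul_iSup_le {S : Type*} [Fintype S] {ι : S → Type*} [∀ s, Nonempty (ι s)]
    {p : S → ℝ} (hp : ∀ s, 0 ≤ p s) {g : ∀ s, ι s → ℝ} {c : ℝ}
    (h : ∀ u : ∀ s, ι s, ∑ s, p s * g s (u s) ≤ c) :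
    ∑ s, p s * ⨆ i, g s i ≤ c := by
  have key := le_sum_mul_iInf hp (g := fun s i => -g s i) (c := -c) fun u => by
    simpa using h u
  have hneg (s : S) : ⨅ i, -g s i = -⨆ i, g s i := by
    simpa using (Real.mul_iSup_of_nonpos (r := -1) (by norm_num) (g s)).symm
  simpa [hneg] using key

theorem iInf_add_sum_mul_eq {S C D : Type*} [Fintype S] {p : S → ℝ} (hp : ∀ s, 0 ≤ p s)
    {U₁ : Set C} (hU₁ : U₁.Nonempty) {U₂ : S → Set D} (hU₂ : ∀ s, (U₂ s).Nonempty)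
    {f : C → ℝ} {g : S → D → ℝ} (hf : BddBelow (Set.range fun u : U₁ => f u))
    (hg : ∀ s, BddBelow (Set.range fun u : U₂ s => g s u)) :
    (⨅ up : {up : C × (S → D) // up.1 ∈ U₁ ∧ ∀ s, up.2 s ∈ U₂ s},
        f up.1.1 + ∑ s, p s * g s (up.1.2 s))
      = (⨅ u : U₁, f u) + ∑ s, p s * ⨅ u : U₂ s, g s u := by
  have := hU₁.to_subtype
  have := fun s => (hU₂ s).to_subtype
  have hle (up : {up : C × (S → D) // up.1 ∈ U₁ ∧ ∀ s, up.2 s ∈ U₂ s}) :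
      (⨅ u : U₁, f u) + ∑ s, p s * ⨅ u : U₂ s, g s u
        ≤ f up.1.1 + ∑ s, p s * g s (up.1.2 s) :=
    add_le_add (ciInf_le hf ⟨up.1.1, up.2.1⟩) <| Finset.sum_le_sum fun s _ =>
      mul_le_mul_of_nonneg_left (ciInf_le (hg s) ⟨up.1.2 s, up.2.2 s⟩) (hp s)
  have : Nonempty {up : C × (S → D) // up.1 ∈ U₁ ∧ ∀ s, up.2 s ∈ U₂ s} :=
    ⟨⟨(hU₁.some, fun s => (hU₂ s).some), hU₁.some_mem, fun s => (hU₂ s).some_mem⟩⟩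
  refine le_antisymm ?_ (le_ciInf hle)
  rw [← sub_le_iff_le_add']
  refine le_sum_mul_iInf hp fun u => ?_
  rw [sub_le_comm]
  refine le_ciInf fun v => ?_
  rw [sub_le_iff_le_add]
  exact ciInf_le (f := fun up : {up : C × (S → D) // up.1 ∈ U₁ ∧ ∀ s, up.2 s ∈ U₂ s} =>
      f up.1.1 + ∑ s, p s * g s (up.1.2 s))
    ⟨_, Set.forall_mem_range.2 hle⟩ ⟨(v, fun s => u s), v.2, fun s => (u s).2⟩

/-- Two-stage finite-scenario dynamic programming reformulation of the preference robust
problem with a rectangular (state-dependent) ambiguity set: the holistic max–min over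
policies and utility selections equals the nested recursion of local max–min problems. -/
theorem two_stage_pro_dynamic_programming
    {S : Type*} [Fintype S] [Nonempty S] (p : S → ℝ) (hp : ∀ s, 0 ≤ p s)
    {A B C D : Type*} (X₁ : Set A) (hX₁ : X₁.Nonempty)
    (X₂ : A → S → Set B) (hX₂ : ∀ x₁ ∈ X₁, ∀ s, (X₂ x₁ s).Nonempty)
    (U₁ : Set C) (hU₁ : U₁.Nonempty)
    (U₂ : S → Set D) (hU₂ : ∀ s, (U₂ s).Nonempty)
    (f₁ : A → C → ℝ) (f₂ : S → B → D → ℝ)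
    (M : ℝ) (hM : 0 ≤ M)
    (hf₁ : ∀ x₁ u₁, |f₁ x₁ u₁| ≤ M)
    (hf₂ : ∀ s x₂ u₂, |f₂ s x₂ u₂| ≤ M) :
    (⨆ xp : {xp : A × (S → B) // xp.1 ∈ X₁ ∧ ∀ s, xp.2 s ∈ X₂ xp.1 s},
      ⨅ up : {up : C × (S → D) // up.1 ∈ U₁ ∧ ∀ s, up.2 s ∈ U₂ s},
        f₁ xp.1.1 up.1.1 + ∑ s, p s * f₂ s (xp.1.2 s) (up.1.2 s))
    = ⨆ x₁ : X₁, ((⨅ u₁ : U₁, f₁ x₁ u₁)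
        + ∑ s, p s * ⨆ x₂ : X₂ (x₁ : A) s, ⨅ u₂ : U₂ s, f₂ s x₂ u₂) := by
  have := hX₁.to_subtype
  have := hU₁.to_subtype
  have := fun s => (hU₂ s).to_subtype
  have bdd₁ (x : A) : BddBelow (Set.range fun u : U₁ => f₁ x u) :=
    ⟨-M, Set.forall_mem_range.2 fun u => (abs_le.1 (hf₁ x u)).1⟩
  have bdd₂ (s : S) (x : B) : BddBelow (Set.range fun u : U₂ s => f₂ s x u) :=
    ⟨-M, Set.forall_mem_range.2 fun u => (abs_le.1 (hf₂ s x u)).1⟩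
  have inf₁_le (x : A) : ⨅ u : U₁, f₁ x u ≤ M :=
    (ciInf_le (bdd₁ x) (Classical.arbitrary _)).trans (abs_le.1 (hf₁ x _)).2
  have inf₂_le (s : S) (x : B) : ⨅ u : U₂ s, f₂ s x u ≤ M :=
    (ciInf_le (bdd₂ s x) (Classical.arbitrary _)).trans (abs_le.1 (hf₂ s x _)).2
  have bdd_value (x₁ : A) (s : S) :
      BddAbove (Set.range fun x₂ : X₂ x₁ s => ⨅ u₂ : U₂ s, f₂ s x₂ u₂) :=
    ⟨M, Set.forall_mem_range.2 fun x₂ => inf₂_le s x₂⟩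
  have bdd_nested : BddAbove (Set.range fun x₁ : X₁ => (⨅ u₁ : U₁, f₁ x₁ u₁)
      + ∑ s, p s * ⨆ x₂ : X₂ (x₁ : A) s, ⨅ u₂ : U₂ s, f₂ s x₂ u₂) := by
    refine ⟨M + ∑ s, p s * M, Set.forall_mem_range.2 fun x₁ => ?_⟩
    have := fun s => (hX₂ x₁ x₁.2 s).to_subtype
    exact add_le_add (inf₁_le x₁) <| Finset.sum_le_sum fun s _ =>
      mul_le_mul_of_nonneg_left (ciSup_le fun x₂ => inf₂_le s x₂) (hp s)
  simp_rw [fun xp : {xp : A × (S → B) // xp.1 ∈ X₁ ∧ ∀ s, xp.2 s ∈ X₂ xp.1 s} =>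
    iInf_add_sum_mul_eq hp hU₁ hU₂ (bdd₁ xp.1.1) fun s => bdd₂ s (xp.1.2 s)]
  have hle (xp : {xp : A × (S → B) // xp.1 ∈ X₁ ∧ ∀ s, xp.2 s ∈ X₂ xp.1 s}) :
      (⨅ u₁ : U₁, f₁ xp.1.1 u₁) + ∑ s, p s * ⨅ u₂ : U₂ s, f₂ s (xp.1.2 s) u₂
        ≤ ⨆ x₁ : X₁, ((⨅ u₁ : U₁, f₁ x₁ u₁)
          + ∑ s, p s * ⨆ x₂ : X₂ (x₁ : A) s, ⨅ u₂ : U₂ s, f₂ s x₂ u₂) := by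
    refine le_trans ?_ (le_ciSup bdd_nested ⟨xp.1.1, xp.2.1⟩)
    exact add_le_add_right (Finset.sum_le_sum fun s _ => mul_le_mul_of_nonneg_left
      (le_ciSup (bdd_value xp.1.1 s) ⟨xp.1.2 s, xp.2.2 s⟩) (hp s)) _
  have : Nonempty {xp : A × (S → B) // xp.1 ∈ X₁ ∧ ∀ s, xp.2 s ∈ X₂ xp.1 s} :=
    ⟨⟨(hX₁.some, fun s => (hX₂ _ hX₁.some_mem s).some), hX₁.some_mem,
      fun s => (hX₂ _ hX₁.some_mem s).some_mem⟩⟩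
  refine le_antisymm (ciSup_le hle) (ciSup_le fun x₁ => ?_)
  have := fun s => (hX₂ x₁ x₁.2 s).to_subtype
  rw [← le_sub_iff_add_le']
  refine sum_mul_iSup_le hp fun x₂ => ?_
  rw [le_sub_iff_add_le']
  exact le_ciSup (f := fun xp : {xp : A × (S → B) // xp.1 ∈ X₁ ∧ ∀ s, xp.2 s ∈ X₂ xp.1 s} =>
      (⨅ u₁ : U₁, f₁ xp.1.1 u₁) + ∑ s, p s * ⨅ u₂ : U₂ s, f₂ s (xp.1.2 s) u₂)
    ⟨_, Set.forall_mem_range.2 hle⟩ ⟨(x₁, fun s => x₂ s), x₁.2, fun s => (x₂ s).2⟩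
end

section
/- Let X be a nonempty set, let (Y, d) be a pseudometric space, and for each x ∈ X let A(x) ⊆ Y and B(x) ⊆ Y be nonempty bounded sets with hausdorffDist(A(x), B(x)) ≤ δ for a fixed δ ≥ 0. Let F : X → Y → ℝ be such that for each x, the function F(x) : Y → ℝ is 1-Lipschitz with respect to d, and suppose there is M ≥ 0 with |F(x)(y)| ≤ M for all x ∈ X, y ∈ Y. Then |sup_{x ∈ X} inf_{y ∈ A(x)} F(x)(y) − sup_{x ∈ X} inf_{y ∈ B(x)} F(x)(y)| ≤ δ. -/
/-- The infimum of a 1-Lipschitz function over a set changes by at most the Hausdorff distance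
when the set is replaced by another one. -/
theorem LipschitzWith.iInf_le_iInf_add_hausdorffDist {Y : Type*} [PseudoMetricSpace Y]
    {f : Y → ℝ} (hf : LipschitzWith 1 f) {s t : Set Y} (hs : s.Nonempty) (ht : t.Nonempty)
    (bs : Bornology.IsBounded s) (bt : Bornology.IsBounded t) :
    ⨅ y : s, f y ≤ (⨅ y : t, f y) + Metric.hausdorffDist s t := by
  have : Nonempty t := ht.to_subtype
  have hbdd : BddBelow (Set.range fun y : s => f y) := by
    rw [← Set.image_eq_range]
    exact (hf.isBounded_image bs).bddBelow
  rw [← sub_le_iff_le_add]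
  refine le_ciInf fun y => le_of_forall_pos_le_add fun ε hε => ?_
  obtain ⟨z, hz, hzy⟩ := Metric.exists_dist_lt_of_hausdorffDist_lt' y.2
    (lt_add_of_pos_right (Metric.hausdorffDist s t) hε)
    (Metric.hausdorffEDist_ne_top_of_nonempty_of_bounded hs ht bs bt)
  have hinf : ⨅ y : s, f y ≤ f z := ciInf_le hbdd ⟨z, hz⟩
  have hlip : f z ≤ f y + dist z y := by simpa using hf.le_add_mul z y
  linarith

/-- Suprema of two real families that are uniformly within `δ` differ by at most `δ`. -/
theorem abs_iSup_sub_iSup_le {ι : Type*} [Nonempty ι] {f g : ι → ℝ} {δ : ℝ}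
    (hf : BddAbove (Set.range f)) (hg : BddAbove (Set.range g)) (h : ∀ i, |f i - g i| ≤ δ) :
    |(⨆ i, f i) - ⨆ i, g i| ≤ δ := by
  refine abs_sub_le_iff.2 ⟨sub_le_iff_le_add.2 (ciSup_le fun i => ?_),
    sub_le_iff_le_add.2 (ciSup_le fun i => ?_)⟩
  · linarith [(abs_sub_le_iff.1 (h i)).1, le_ciSup hg i]
  · linarith [(abs_sub_le_iff.1 (h i)).2, le_ciSup hf i]

/-- One-stage error bound: replacing the ambiguity sets `A x` by approximating ambiguity
sets `B x` within Hausdorff distance `δ` perturbs the optimal value of the max–min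
problem by at most `δ`, provided the objective is 1-Lipschitz in the ambiguity variable
and uniformly bounded. -/
theorem abs_iSup_iInf_sub_iSup_iInf_le_of_hausdorffDist
    {X : Type*} [Nonempty X] {Y : Type*} [PseudoMetricSpace Y]
    (A B : X → Set Y) (δ : ℝ) (hδ : 0 ≤ δ)
    (hAne : ∀ x, (A x).Nonempty) (hBne : ∀ x, (B x).Nonempty)
    (hAbd : ∀ x, Bornology.IsBounded (A x)) (hBbd : ∀ x, Bornology.IsBounded (B x))
    (hH : ∀ x, Metric.hausdorffDist (A x) (B x) ≤ δ)
    (F : X → Y → ℝ) (hF : ∀ x, LipschitzWith 1 (F x))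
    (M : ℝ) (hM : 0 ≤ M) (hFbd : ∀ x y, |F x y| ≤ M) :
    |(⨆ x, ⨅ y : A x, F x y) - ⨆ x, ⨅ y : B x, F x y| ≤ δ := by
  have hbdd : ∀ C : X → Set Y, (∀ x, (C x).Nonempty) →
      BddAbove (Set.range fun x => ⨅ y : C x, F x y) := by
    intro C hC
    refine ⟨M, Set.forall_mem_range.2 fun x => ?_⟩
    obtain ⟨y, hy⟩ := hC x
    have hbelow : BddBelow (Set.range fun y : C x => F x y) :=
      ⟨-M, Set.forall_mem_range.2 fun y => (abs_le.1 (hFbd x y)).1⟩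
    exact (ciInf_le hbelow ⟨y, hy⟩).trans (abs_le.1 (hFbd x y)).2
  refine abs_iSup_sub_iSup_le (hbdd A hAne) (hbdd B hBne) fun x => abs_sub_le_iff.2 ⟨?_, ?_⟩
  · linarith [hH x, (hF x).iInf_le_iInf_add_hausdorffDist (hAne x) (hBne x) (hAbd x) (hBbd x)]
  · have hBA := (hF x).iInf_le_iInf_add_hausdorffDist (hBne x) (hAne x) (hBbd x) (hAbd x)
    rw [Metric.hausdorffDist_comm] at hBA
    linarith [hH x]
end
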